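/- For all nonnegative integers n, the sequence p_n = \sum_{k=0}^n \binom{n}{k}^2 k! (2 H_{n-k} - H_k), where H_m denotes the m-th harmonic number (with H_0 = 0), satisfies the inhomogeneous recurrence p_{n+2} - 2(n+2) p_{n+1} + (n+1)^2 p_n = -n/(n+2). -/

import Mathlib

open Finset

noncomputable def H (m : ℕ) : ℚ := ∑ j ∈ Finset.range m, (1 : ℚ) / (j + 1)

noncomputable def p (n : ℕ) : ℚ :=
  ∑ k ∈ Finset.range (n + 1),
    ((n.choose k : ℚ))^2 * (Nat.factorial k : ℚ) * (2 * H (n - k) - H k)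

theorem H_succ (m : ℕ) : H (m + 1) = H m + 1 / ((m : ℚ) + 1) := by
  simp [H, Finset.sum_range_succ]

/-- The `k`-th summand of `p n`. -/
noncomputable def pTerm (n k : ℕ) : ℚ :=
  ((n.choose k : ℚ))^2 * (Nat.factorial k : ℚ) * (2 * H (n - k) - H k)

theorem pTerm_add (k j : ℕ) :
    pTerm (k + j) k = ((k + j).factorial : ℚ)^2 / ((j.factorial : ℚ)^2 * k.factorial)
      * (2 * H j - H k) := by
  have hk : (k.factorial : ℚ) ≠ 0 := by positivity
  have hj : (j.factorial : ℚ) ≠ 0 := by positivity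
  rw [pTerm, Nat.cast_add_choose, Nat.add_sub_cancel_left]
  field_simp

/-- The telescoping certificate for `p_recurrence`, evaluated at `n = k + m - 2`: the derivative
in `k` of the Zeilberger certificate for `∑ k, (n.choose k)^2 * k!`. -/
noncomputable def pCert (n k m : ℕ) : ℚ :=
  ((n + 1).factorial : ℚ)^2 / ((m.factorial : ℚ)^2 * k.factorial) *
    (k * ((m : ℚ)^2 - m - (n + 2)) * (2 * H m - H k)
      + ((m : ℚ)^2 - m - (n + 2)) - k * (2 * m - 1))

theorem pTerm_recurrence (k j : ℕ) :
    pTerm (k + j + 2) k - 2 * ((k : ℚ) + j + 2) * pTerm (k + j + 1) k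
      + ((k : ℚ) + j + 1)^2 * pTerm (k + j) k
      = pCert (k + j) (k + 1) (j + 1) - pCert (k + j) k (j + 2) := by
  have hk : (k.factorial : ℚ) ≠ 0 := by positivity
  have hj : (j.factorial : ℚ) ≠ 0 := by positivity
  have h1 : (j : ℚ) + 1 ≠ 0 := by positivity
  have h2 : (j : ℚ) + 2 ≠ 0 := by positivity
  have h3 : (j : ℚ) + 1 + 1 ≠ 0 := by positivity
  have h4 : (k : ℚ) + 1 ≠ 0 := by positivity
  rw [add_assoc k j 2, add_assoc k j 1, pTerm_add, pTerm_add, pTerm_add, pCert, pCert]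
  simp only [← add_assoc, Nat.factorial_succ, H_succ]
  push_cast
  field_simp
  ring

theorem p_eq_sum_pTerm (n : ℕ) : p n = ∑ k ∈ Finset.range (n + 1), pTerm n k := rfl

theorem p_recurrence (n : ℕ) :
    p (n + 2) - 2 * ((n : ℚ) + 2) * p (n + 1) + ((n : ℚ) + 1)^2 * p n
      = -(n : ℚ) / ((n : ℚ) + 2) := by
  have hsum : ∑ k ∈ Finset.range (n + 1), (pTerm (n + 2) k - 2 * ((n : ℚ) + 2) * pTerm (n + 1) k
      + ((n : ℚ) + 1)^2 * pTerm n k) = pCert n (n + 1) 1 - pCert n 0 (n + 2) := by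
    have htel := Finset.sum_range_sub (fun k => pCert n k (n + 2 - k)) (n + 1)
    rw [show n + 2 - (n + 1) = 1 by omega, Nat.sub_zero] at htel
    rw [← htel]
    refine Finset.sum_congr rfl fun k hk => ?_
    obtain ⟨j, rfl⟩ := Nat.exists_eq_add_of_le (Finset.mem_range_succ_iff.mp hk)
    rw [show k + j + 2 - (k + 1) = j + 1 by omega, show k + j + 2 - k = j + 2 by omega,
      ← pTerm_recurrence]
    push_cast
    ring
  rw [Finset.sum_add_distrib, Finset.sum_sub_distrib, ← Finset.mul_sum, ← Finset.mul_sum] at hsum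
  rw [p_eq_sum_pTerm, p_eq_sum_pTerm, p_eq_sum_pTerm, Finset.sum_range_succ _ (n + 2),
    Finset.sum_range_succ _ (n + 1), Finset.sum_range_succ (pTerm (n + 1)) (n + 1)]
  have hH : H 0 = 0 := by simp [H]
  have hH1 : H 1 = 1 := by simp [H]
  have e1 := pTerm_add (n + 1) 1
  have e2 := pTerm_add (n + 2) 0
  have e3 := pTerm_add (n + 1) 0
  have hn : (n.factorial : ℚ) ≠ 0 := by positivity
  have h1 : (n : ℚ) + 1 ≠ 0 := by positivity
  have h2 : (n : ℚ) + 2 ≠ 0 := by positivity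
  have h3 : (n : ℚ) + 1 + 1 ≠ 0 := by positivity
  have hbdry : pCert n (n + 1) 1 - pCert n 0 (n + 2) + pTerm (n + 2) (n + 1)
      + pTerm (n + 2) (n + 2) - 2 * ((n : ℚ) + 2) * pTerm (n + 1) (n + 1)
      = -(n : ℚ) / ((n : ℚ) + 2) := by
    simp only [add_zero, add_assoc, Nat.reduceAdd] at e1 e2 e3
    rw [e1, e2, e3, pCert, pCert]
    simp only [Nat.factorial_succ, H_succ, hH, Nat.factorial_zero]
    push_cast
    field_simp
    ring
  linear_combination hsum + hbdry
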